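/- Let σ ∈ [0,1], let E be a finite-dimensional normed vector space, let (l_j)_{j≥1} and (m_j)_{j≥1} be strictly decreasing real sequences tending to -∞, and let a_j ∈ S_σ^{l_j, m_j}(ℝ^{2n}, E) for every j. Then: (i) there exists a ∈ S_σ^{l_1, m_1}(ℝ^{2n}, E) such that a - Σ_{j=1}^{k-1} a_j ∈ S_σ^{l_k, m_k}(ℝ^{2n}, E) for every k ≥ 2; (ii) if a' ∈ S_σ^{l_1, m_1}(ℝ^{2n}, E) also satisfies this property, then a - a' ∈ S_σ^{-∞}(ℝ^{2n}, E) := ∩_{l,m∈ℝ} S_σ^{l,m}(ℝ^{2n}, E). -/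

import Mathlib

open MeasureTheory
open scoped BigOperators

noncomputable section

/-- Japanese bracket `⟨v⟩ = (1 + ‖v‖²)^(1/2)` (with the Euclidean norm). -/
def jb {n : ℕ} (v : Fin n → ℝ) : ℝ := Real.sqrt (1 + ∑ i, (v i) ^ 2)

/-- Japanese bracket of a pair of vectors, `⟨(x,y)⟩`. -/
def jb2 {n m : ℕ} (x : Fin n → ℝ) (y : Fin m → ℝ) : ℝ :=
  Real.sqrt (1 + ∑ i, (x i) ^ 2 + ∑ j, (y j) ^ 2)

/-- Euclidean inner product `⟨ϑ, ζ⟩`. -/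
def ip {n : ℕ} (ϑ ζ : Fin n → ℝ) : ℝ := ∑ i, ϑ i * ζ i

/-- Partial derivative in the `i`-th coordinate direction. -/
def pd {n : ℕ} {E : Type*} [NormedAddCommGroup E] [NormedSpace ℝ E]
    (i : Fin n) (f : (Fin n → ℝ) → E) : (Fin n → ℝ) → E :=
  fun x => fderiv ℝ f x (Pi.single i 1)

/-- Iterated partial derivative `∂^ν` along the multi-index `ν`. -/
def pdm {n : ℕ} {E : Type*} [NormedAddCommGroup E] [NormedSpace ℝ E]
    (ν : Fin n → ℕ) (f : (Fin n → ℝ) → E) : (Fin n → ℝ) → E :=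
  (List.finRange n).foldr (fun i g => (pd i)^[ν i] g) f

/-- Mixed partial derivative `∂_x^α ∂_y^β` of a function of two vector variables. -/
def pdm2 {n m : ℕ} {E : Type*} [NormedAddCommGroup E] [NormedSpace ℝ E]
    (α : Fin n → ℕ) (β : Fin m → ℕ) (f : (Fin n → ℝ) → (Fin m → ℝ) → E) :
    (Fin n → ℝ) → (Fin m → ℝ) → E :=
  fun x y => pdm α (fun x' => pdm β (f x') y) x

/-- Mixed partial derivative `∂_x^α ∂_y^β ∂_z^γ` of a function of three vector variables. -/
def pdm3 {n m k : ℕ} {E : Type*} [NormedAddCommGroup E] [NormedSpace ℝ E]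
    (α : Fin n → ℕ) (β : Fin m → ℕ) (γ : Fin k → ℕ)
    (f : (Fin n → ℝ) → (Fin m → ℝ) → (Fin k → ℝ) → E) :
    (Fin n → ℝ) → (Fin m → ℝ) → (Fin k → ℝ) → E :=
  fun x y z => pdm α (fun x' => pdm β (fun y' => pdm γ (f x' y') z) y) x

/-- Length `|ν|` of a multi-index. -/
def msize {n : ℕ} (ν : Fin n → ℕ) : ℕ := ∑ i, ν i

/-- The class `G_σ(ℝ^n, E)`: smooth functions whose `ν`-th derivative is
`O(⟨v⟩^{-σ(|ν|-1)})` for every `ν ≠ 0`. -/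
def GsigmaCl {n : ℕ} {E : Type*} [NormedAddCommGroup E] [NormedSpace ℝ E]
    (σ : ℝ) (f : (Fin n → ℝ) → E) : Prop :=
  ContDiff ℝ (⊤ : ℕ∞) f ∧ ∀ ν : Fin n → ℕ, ν ≠ 0 → ∃ C > 0, ∀ v,
    ‖pdm ν f v‖ ≤ C * jb v ^ (-(σ * ((msize ν : ℝ) - 1)))

/-- The class `S_σ(ℝ^n)`: smooth real functions whose `ν`-th derivative is
`O(⟨v⟩^{-σ|ν|})` for every `ν`. -/
def SsigmaCl {n : ℕ} (σ : ℝ) (f : (Fin n → ℝ) → ℝ) : Prop :=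
  ContDiff ℝ (⊤ : ℕ∞) f ∧ ∀ ν : Fin n → ℕ, ∃ C > 0, ∀ v,
    |pdm ν f v| ≤ C * jb v ^ (-(σ * (msize ν : ℝ)))

/-- `G_σ^×(ℝ^p)`: diffeomorphisms `g` of `ℝ^p` with `g` and `g⁻¹` in `G_σ`. -/
def GsigmaX {p : ℕ} (σ : ℝ) (g : (Fin p → ℝ) → (Fin p → ℝ)) : Prop :=
  ∃ h : (Fin p → ℝ) → (Fin p → ℝ),
    Function.LeftInverse h g ∧ Function.RightInverse h g ∧ GsigmaCl σ g ∧ GsigmaCl σ h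

/-- The class `O_M(ℝ^n, E)`: smooth functions with polynomially bounded derivatives. -/
def OMCl {n : ℕ} {E : Type*} [NormedAddCommGroup E] [NormedSpace ℝ E]
    (f : (Fin n → ℝ) → E) : Prop :=
  ContDiff ℝ (⊤ : ℕ∞) f ∧ ∀ ν : Fin n → ℕ, ∃ C > 0, ∃ k : ℕ, ∀ v,
    ‖pdm ν f v‖ ≤ C * jb v ^ (k : ℝ)

/-- `O_M^×(ℝ^p, ℝ^p)`: diffeomorphisms `g` of `ℝ^p` with `g` and `g⁻¹` in `O_M`. -/
def OMX {p : ℕ} (g : (Fin p → ℝ) → (Fin p → ℝ)) : Prop :=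
  ∃ h : (Fin p → ℝ) → (Fin p → ℝ),
    Function.LeftInverse h g ∧ Function.RightInverse h g ∧ OMCl g ∧ OMCl h

/-- The symbol space `S_σ^{l,m}(ℝ^{2n}, E)`. -/
def Ssym {n : ℕ} {E : Type*} [NormedAddCommGroup E] [NormedSpace ℝ E]
    (σ l m : ℝ) (a : (Fin n → ℝ) → (Fin n → ℝ) → E) : Prop :=
  ContDiff ℝ (⊤ : ℕ∞) (fun q : (Fin n → ℝ) × (Fin n → ℝ) => a q.1 q.2) ∧
  ∀ α β : Fin n → ℕ, ∃ C > 0, ∀ x ϑ,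
    ‖pdm2 α β a x ϑ‖ ≤ C * jb x ^ (σ * (l - (msize α : ℝ))) * jb ϑ ^ (m - (msize β : ℝ))

/-- The amplitude space `Π_{σ,κ}^{l,w,m}(ℝ^{3n}, E)`. -/
def Amp {n : ℕ} {E : Type*} [NormedAddCommGroup E] [NormedSpace ℝ E]
    (σ κ l w m : ℝ) (a : (Fin n → ℝ) → (Fin n → ℝ) → (Fin n → ℝ) → E) : Prop :=
  ContDiff ℝ (⊤ : ℕ∞)
    (fun q : ((Fin n → ℝ) × (Fin n → ℝ)) × (Fin n → ℝ) => a q.1.1 q.1.2 q.2) ∧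
  ∀ α β γ : Fin n → ℕ, ∃ C > 0, ∀ x ζ ϑ,
    ‖pdm3 α β γ a x ζ ϑ‖ ≤
      C * jb x ^ (σ * (l - ((msize α + msize β : ℕ) : ℝ))) *
        jb ζ ^ (w + κ * ((msize α + msize β : ℕ) : ℝ)) * jb ϑ ^ (m - (msize γ : ℝ))

/-- The space `H_{σ,κ}^{w}(E)` of smooth functions on `ℝ^{2n}`. -/
def Hsp {n : ℕ} {F : Type*} [NormedAddCommGroup F] [NormedSpace ℝ F]
    (σ κ w : ℝ) (g : (Fin n → ℝ) → (Fin n → ℝ) → F) : Prop :=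
  ContDiff ℝ (⊤ : ℕ∞) (fun q : (Fin n → ℝ) × (Fin n → ℝ) => g q.1 q.2) ∧
  ∀ α β : Fin n → ℕ, ¬(α = 0 ∧ β = 0) → ∃ C > 0, ∀ x ζ,
    ‖pdm2 α β g x ζ‖ ≤ C * jb x ^ (-(σ * (((msize α + msize β : ℕ) : ℝ) - 1))) *
      jb ζ ^ (w + κ * (((msize α + msize β : ℕ) : ℝ) - 1))

/-- The space `E_{σ,κ}^{w}(E)` of smooth functions on `ℝ^{2n}`. -/
def Esp {n : ℕ} {F : Type*} [NormedAddCommGroup F] [NormedSpace ℝ F]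
    (σ κ w : ℝ) (g : (Fin n → ℝ) → (Fin n → ℝ) → F) : Prop :=
  ContDiff ℝ (⊤ : ℕ∞) (fun q : (Fin n → ℝ) × (Fin n → ℝ) => g q.1 q.2) ∧
  ∀ α β : Fin n → ℕ, ∃ C > 0, ∀ x ζ,
    ‖pdm2 α β g x ζ‖ ≤ C * jb x ^ (-(σ * ((msize α + msize β : ℕ) : ℝ))) *
      jb ζ ^ (w + κ * ((msize α + msize β : ℕ) : ℝ))

/-- Jacobian determinant of a map `ℝ^p → ℝ^p`. -/
def Jdet {p : ℕ} (g : (Fin p → ℝ) → (Fin p → ℝ)) : (Fin p → ℝ) → ℝ :=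
  fun v => LinearMap.det (fderiv ℝ g v).toLinearMap

/-- The seminorm `q_{p,(α,β)}(K) = sup ⟨(x,y)⟩^p |∂^{(α,β)} K (x,y)|`. -/
def qSem {n : ℕ} (p : ℕ) (α β : Fin n → ℕ)
    (K : (Fin n → ℝ) → (Fin n → ℝ) → ℂ) : ℝ :=
  ⨆ q : (Fin n → ℝ) × (Fin n → ℝ), jb2 q.1 q.2 ^ p * ‖pdm2 α β K q.1 q.2‖

/-- Mixed partial derivative `∂_r^α ∂_θ^β` of a function of two real variables. -/
def pd2 (α β : ℕ) (F : ℝ → ℝ → ℝ) (r θ : ℝ) : ℝ :=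
  iteratedDeriv α (fun r' => iteratedDeriv β (fun θ' => F r' θ') θ) r

/-- Smooth real function on `ℝ` with all derivatives bounded. -/
def BddSmooth (a : ℝ → ℝ) : Prop :=
  ContDiff ℝ (⊤ : ℕ∞) a ∧ ∀ k : ℕ, ∃ C : ℝ, ∀ t, |iteratedDeriv k a t| ≤ C

/-- Inverse hyperbolic cosine, `arcosh x = log (x + √(x²-1))`. -/
def arcosh (x : ℝ) : ℝ := Real.log (x + Real.sqrt (x ^ 2 - 1))

section gen

variable {X : Type*} [NormedAddCommGroup X] [NormedSpace ℝ X]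
variable {E : Type*} [NormedAddCommGroup E] [NormedSpace ℝ E]
variable {ι : Type*} {P : Type*}

/-- directional derivative -/
def DD (v : X) (f : X → E) : X → E := fun q => fderiv ℝ f q v

/-- weighted bounds for all iterated directional derivatives up to order `N`. -/
def FBC (e : ι → X) (ω : ι → X → ℝ) (C : ℝ) : ℕ → (P → X → ℝ) → (P → X → E) → Prop
  | 0, μ, F => ∀ p q, ‖F p q‖ ≤ C * μ p q
  | N + 1, μ, F => (∀ p q, ‖F p q‖ ≤ C * μ p q) ∧
      ∀ i, FBC e ω C N (fun p q => μ p q * ω i q) (fun p => DD (e i) (F p))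

def FB (e : ι → X) (ω : ι → X → ℝ) (N : ℕ) (μ : P → X → ℝ) (F : P → X → E) : Prop :=
  ∃ C, 0 ≤ C ∧ FBC e ω C N μ F

def Sm (f : X → E) : Prop := ContDiff ℝ (⊤ : ℕ∞) f

theorem Sm.diff {f : X → E} (hf : Sm f) : Differentiable ℝ f :=
  ContDiff.differentiable hf (by simp)

theorem Sm.DD {f : X → E} (hf : Sm f) (v : X) : Sm (DD v f) := by
  have h : ContDiff ℝ (⊤ : ℕ∞) (fderiv ℝ f) := ContDiff.fderiv_right hf (by simp)
  exact h.clm_apply contDiff_const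

theorem DD_comm {f : X → E} (hf : Sm f) (v w : X) : DD v (DD w f) = DD w (DD v f) := by
  funext q
  have h : ContDiff ℝ (⊤ : ℕ∞) (fderiv ℝ f) := ContDiff.fderiv_right hf (by simp)
  have hd : DifferentiableAt ℝ (fderiv ℝ f) q := h.differentiable (by simp) q
  have key : ∀ a b : X, DD a (DD b f) q = fderiv ℝ (fderiv ℝ f) q a b := by
    intro a b
    have : HasFDerivAt (fun y => fderiv ℝ f y b) ((fderiv ℝ (fderiv ℝ f) q).flip b) q := by
      have := hd.hasFDerivAt.clm_apply (hasFDerivAt_const b q)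
      simpa using this
    show fderiv ℝ (fun y => fderiv ℝ f y b) q a = _
    rw [this.fderiv]; rfl
  rw [key, key]
  have hs : IsSymmSndFDerivAt ℝ f q := by
    have hq : ContDiffAt ℝ (⊤ : ℕ∞) f q := ContDiff.contDiffAt hf
    apply hq.isSymmSndFDerivAt
    simp only [minSmoothness_of_isRCLikeNormedField]
    exact WithTop.coe_le_coe.2 (by exact_mod_cast (le_top : (2 : ℕ∞) ≤ ⊤))
  exact hs.eq v w

theorem DD_add {f g : X → E} (hf : Sm f) (hg : Sm g) (v : X) :
    DD v (fun q => f q + g q) = fun q => DD v f q + DD v g q := by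
  funext q
  simp only [DD]
  rw [fderiv_fun_add (hf.diff q) (hg.diff q)]; rfl

theorem DD_smul {f : X → ℝ} {g : X → E} (hf : Sm f) (hg : Sm g) (v : X) :
    DD v (fun q => f q • g q) = fun q => DD v f q • g q + f q • DD v g q := by
  funext q
  simp only [DD]
  rw [fderiv_fun_smul (hf.diff q) (hg.diff q)]
  simp [add_comm]

theorem DD_const (c : E) (v : X) : DD v (fun _ : X => c) = fun _ => 0 := by
  funext q; simp [DD]

theorem Sm.add {f g : X → E} (hf : Sm f) (hg : Sm g) : Sm (fun q => f q + g q) :=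
  ContDiff.add hf hg

theorem Sm.smul {f : X → ℝ} {g : X → E} (hf : Sm f) (hg : Sm g) : Sm (fun q => f q • g q) :=
  ContDiff.smul hf hg

theorem Sm.const (c : E) : Sm (fun _ : X => c) := contDiff_const

variable {e : ι → X} {ω : ι → X → ℝ}

theorem FBC.bd {C : ℝ} {N : ℕ} {μ : P → X → ℝ} {F : P → X → E} (h : FBC e ω C N μ F) :
    ∀ p q, ‖F p q‖ ≤ C * μ p q := by
  cases N with
  | zero => exact h
  | succ N => exact h.1

theorem FBC.lower {C : ℝ} {N : ℕ} : ∀ {μ : P → X → ℝ} {F : P → X → E},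
    FBC e ω C (N + 1) μ F → FBC e ω C N μ F := by
  induction N with
  | zero => intro μ F h; exact h.1
  | succ N ih => intro μ F h; exact ⟨h.1, fun i => ih (h.2 i)⟩

theorem FBC.lower_le {C : ℝ} {N M : ℕ} (hNM : N ≤ M) {μ : P → X → ℝ} {F : P → X → E}
    (h : FBC e ω C M μ F) : FBC e ω C N μ F := by
  induction M, hNM using Nat.le_induction with
  | base => exact h
  | succ M _ ih => exact ih h.lower

theorem FBC.mono (hω : ∀ i q, 0 ≤ ω i q) {C C' : ℝ} {N : ℕ} : ∀ {μ ν : P → X → ℝ} {F : P → X → E},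
    (∀ p q, C * μ p q ≤ C' * ν p q) → FBC e ω C N μ F → FBC e ω C' N ν F := by
  induction N with
  | zero => intro μ ν F h hF p q; exact (hF p q).trans (h p q)
  | succ N ih =>
    intro μ ν F h hF
    refine ⟨fun p q => (hF.1 p q).trans (h p q), fun i => ih ?_ (hF.2 i)⟩
    intro p q
    have := mul_le_mul_of_nonneg_right (h p q) (hω i q)
    simpa [mul_assoc] using this

theorem FBC.add {C C' : ℝ} {N : ℕ} : ∀ {μ : P → X → ℝ} {F G : P → X → E},
    (∀ p, Sm (F p)) → (∀ p, Sm (G p)) → 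
    FBC e ω C N μ F → FBC e ω C' N μ G → FBC e ω (C + C') N μ (fun p q => F p q + G p q) := by
  induction N with
  | zero =>
    intro μ F G _ _ h h' p q
    exact (norm_add_le _ _).trans (by linarith [h p q, h' p q])
  | succ N ih =>
    intro μ F G hF hG h h'
    refine ⟨fun p q => (norm_add_le _ _).trans (by linarith [h.1 p q, h'.1 p q]), fun i => ?_⟩
    simp only [DD_add (hF _) (hG _)]
    exact ih (fun p => (hF p).DD _) (fun p => (hG p).DD _) (h.2 i) (h'.2 i)

theorem FB.bd {N : ℕ} {μ : P → X → ℝ} {F : P → X → E} (h : FB e ω N μ F) :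
    ∃ C, 0 ≤ C ∧ ∀ p q, ‖F p q‖ ≤ C * μ p q := by
  obtain ⟨C, hC, h⟩ := h
  exact ⟨C, hC, h.bd⟩

theorem FB.lower {N : ℕ} {μ : P → X → ℝ} {F : P → X → E} (h : FB e ω (N + 1) μ F) :
    FB e ω N μ F := by
  obtain ⟨C, hC, h⟩ := h
  exact ⟨C, hC, h.lower⟩

theorem FB.mono (hω : ∀ i q, 0 ≤ ω i q) {N : ℕ} {μ ν : P → X → ℝ} {F : P → X → E}
    {K : ℝ} (hK : 0 ≤ K) (h : ∀ p q, μ p q ≤ K * ν p q) (hF : FB e ω N μ F) :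
    FB e ω N ν F := by
  obtain ⟨C, hC, hF⟩ := hF
  refine ⟨C * K, by positivity, hF.mono hω ?_⟩
  intro p q
  rw [mul_assoc]
  exact mul_le_mul_of_nonneg_left (h p q) hC

theorem FB.mono1 (hω : ∀ i q, 0 ≤ ω i q) {N : ℕ} {μ ν : P → X → ℝ} {F : P → X → E}
    (h : ∀ p q, μ p q ≤ ν p q) (hF : FB e ω N μ F) :
    FB e ω N ν F := hF.mono hω zero_le_one (by simpa using h)

theorem FB.add {N : ℕ} {μ : P → X → ℝ} {F G : P → X → E}
    (hF : ∀ p, Sm (F p)) (hG : ∀ p, Sm (G p))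
    (h : FB e ω N μ F) (h' : FB e ω N μ G) : FB e ω N μ (fun p q => F p q + G p q) := by
  obtain ⟨C, hC, h⟩ := h
  obtain ⟨C', hC', h'⟩ := h'
  exact ⟨C + C', by positivity, h.add hF hG h'⟩

theorem FB.deriv {N : ℕ} {μ : P → X → ℝ} {F : P → X → E}
    (h : FB e ω (N + 1) μ F) (i : ι) :
    FB e ω N (fun p q => μ p q * ω i q) (fun p => DD (e i) (F p)) := by
  obtain ⟨C, hC, h⟩ := h
  exact ⟨C, hC, h.2 i⟩

theorem FB.step [Fintype ι] (hω : ∀ i q, 0 ≤ ω i q) {N : ℕ} {μ : P → X → ℝ} {F : P → X → E}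
    (hμ : ∀ p q, 0 ≤ μ p q) {C : ℝ} (hC : 0 ≤ C) (h0 : ∀ p q, ‖F p q‖ ≤ C * μ p q)
    (h : ∀ i, FB e ω N (fun p q => μ p q * ω i q) (fun p => DD (e i) (F p))) :
    FB e ω (N + 1) μ F := by
  choose D hD h using h
  refine ⟨C + ∑ i, D i, add_nonneg hC (Finset.sum_nonneg fun i _ => hD i), ?_, fun i => ?_⟩
  · intro p q
    refine (h0 p q).trans (mul_le_mul_of_nonneg_right ?_ (hμ p q))
    linarith [Finset.sum_nonneg (s := Finset.univ) fun i _ => hD i]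
  · refine (h i).mono hω fun p q => ?_
    refine mul_le_mul_of_nonneg_right ?_ (mul_nonneg (hμ p q) (hω i q))
    linarith [Finset.single_le_sum (s := Finset.univ) (fun i _ => hD i) (Finset.mem_univ i)]

theorem FB.of_bd {μ : P → X → ℝ} {F : P → X → E}
    {C : ℝ} (hC : 0 ≤ C) (h0 : ∀ p q, ‖F p q‖ ≤ C * μ p q) : FB e ω 0 μ F := ⟨C, hC, h0⟩

theorem FB.zero [Fintype ι] (hω : ∀ i q, 0 ≤ ω i q) {N : ℕ} : ∀ {μ : P → X → ℝ},
    (∀ p q, 0 ≤ μ p q) → FB e ω N μ (fun _ _ => (0 : E)) := by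
  induction N with
  | zero => intro μ hμ; exact FB.of_bd zero_le_one (by simpa using hμ)
  | succ N ih =>
    intro μ hμ
    refine FB.step hω hμ zero_le_one (by simpa using hμ) fun i => ?_
    simp only [DD_const]
    exact ih fun p q => mul_nonneg (hμ p q) (hω i q)

theorem FB.const [Fintype ι] (hω : ∀ i q, 0 ≤ ω i q) {N : ℕ} {μ : P → X → ℝ}
    (c : P → E) (h : ∀ p q, ‖c p‖ ≤ μ p q) : FB e ω N μ (fun p _ => c p) := by
  have hμ : ∀ p q, 0 ≤ μ p q := fun p q => (norm_nonneg _).trans (h p q)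
  cases N with
  | zero => exact FB.of_bd zero_le_one (by simpa using h)
  | succ N =>
    refine FB.step hω hμ zero_le_one (by simpa using h) fun i => ?_
    simp only [DD_const]
    exact FB.zero hω fun p q => mul_nonneg (hμ p q) (hω i q)

theorem FB.smul [Fintype ι] (hω : ∀ i q, 0 ≤ ω i q) {N : ℕ} : ∀ {μ ν : P → X → ℝ}
    {φ : P → X → ℝ} {F : P → X → E}, (∀ p q, 0 ≤ μ p q) → (∀ p q, 0 ≤ ν p q) →
    (∀ p, Sm (φ p)) → (∀ p, Sm (F p)) → FB e ω N μ φ → FB e ω N ν F →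
    FB e ω N (fun p q => μ p q * ν p q) (fun p q => φ p q • F p q) := by
  have B : ∀ {N : ℕ} {μ ν : P → X → ℝ} {φ : P → X → ℝ} {F : P → X → E},
      FB e ω N μ φ → FB e ω N ν F → ∃ C, 0 ≤ C ∧ ∀ p q, ‖φ p q • F p q‖ ≤ C * (μ p q * ν p q) := by
    intro N μ ν φ F h h'
    obtain ⟨C, hC, h⟩ := h.bd
    obtain ⟨C', hC', h'⟩ := h'.bd
    refine ⟨C * C', by positivity, fun p q => ?_⟩
    rw [norm_smul]
    calc _ ≤ (C * μ p q) * (C' * ν p q) :=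
          mul_le_mul (h p q) (h' p q) (norm_nonneg _) ((norm_nonneg _).trans (h p q))
      _ = _ := by ring
  induction N with
  | zero =>
    intro μ ν φ F hμ hν hφ hF h h'
    obtain ⟨C, hC, h⟩ := B h h'
    exact FB.of_bd hC h
  | succ N ih =>
    intro μ ν φ F hμ hν hφ hF h h'
    obtain ⟨C, hC, hb⟩ := B h h'
    refine FB.step hω (fun p q => mul_nonneg (hμ p q) (hν p q)) hC hb fun i => ?_
    simp only [DD_smul (hφ _) (hF _)]
    refine FB.add (fun p => ((hφ p).DD _).smul (hF p)) (fun p => (hφ p).smul ((hF p).DD _)) ?_ ?_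
    · refine (ih (fun p q => mul_nonneg (hμ p q) (hω i q)) hν (fun p => (hφ p).DD _) hF
        (h.deriv i) h'.lower).mono1 hω ?_
      intro p q; exact le_of_eq (by ring)
    · refine (ih hμ (fun p q => mul_nonneg (hν p q) (hω i q)) hφ (fun p => (hF p).DD _)
        h.lower (h'.deriv i)).mono1 hω ?_
      intro p q; exact le_of_eq (by ring)

theorem FB.csmul [Fintype ι] (hω : ∀ i q, 0 ≤ ω i q) {N : ℕ} {ν : P → X → ℝ}
    {F : P → X → E} (c : P → ℝ) (hν : ∀ p q, 0 ≤ ν p q) (hF : ∀ p, Sm (F p))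
    (h : FB e ω N ν F) : FB e ω N (fun p q => |c p| * ν p q) (fun p q => c p • F p q) :=
  FB.smul hω (μ := fun p _ => |c p|) (φ := fun p _ => c p) (fun _ _ => abs_nonneg _) hν
    (fun _ => Sm.const _) hF (FB.const hω c fun _ _ => le_rfl) h

theorem FB.neg [Fintype ι] (hω : ∀ i q, 0 ≤ ω i q) {N : ℕ} {ν : P → X → ℝ}
    {F : P → X → E} (hν : ∀ p q, 0 ≤ ν p q) (hF : ∀ p, Sm (F p))
    (h : FB e ω N ν F) : FB e ω N ν (fun p q => - F p q) := by
  have := FB.csmul hω (fun _ => -1) hν hF h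
  simpa using this

theorem FB.sub [Fintype ι] (hω : ∀ i q, 0 ≤ ω i q) {N : ℕ} {ν : P → X → ℝ}
    {F G : P → X → E} (hν : ∀ p q, 0 ≤ ν p q) (hF : ∀ p, Sm (F p)) (hG : ∀ p, Sm (G p))
    (h : FB e ω N ν F) (h' : FB e ω N ν G) : FB e ω N ν (fun p q => F p q - G p q) := by
  simp only [sub_eq_add_neg]
  exact FB.add hF (fun p => (hG p).neg) h (FB.neg hω hν hG h')

theorem Sm.sum {κ : Type*} (s : Finset κ) {F : κ → X → E} (hF : ∀ k ∈ s, Sm (F k)) :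
    Sm (fun q => ∑ k ∈ s, F k q) := ContDiff.sum hF

theorem FB.sum [Fintype ι] (hω : ∀ i q, 0 ≤ ω i q) {N : ℕ} {ν : P → X → ℝ} {κ : Type*}
    (s : Finset κ) {F : κ → P → X → E} (hν : ∀ p q, 0 ≤ ν p q) (hF : ∀ k p, Sm (F k p))
    (h : ∀ k ∈ s, FB e ω N ν (F k)) : FB e ω N ν (fun p q => ∑ k ∈ s, F k p q) := by
  classical
  induction s using Finset.induction_on with
  | empty => simpa using FB.zero hω hν
  | insert a s ha ih =>
    simp only [Finset.sum_insert ha]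
    exact FB.add (hF a) (fun p => Sm.sum s fun k _ => hF k p) (h a (by simp))
      (ih fun k hk => h k (by simp [hk]))

/-- powers -/
theorem FB.rpow [Fintype ι] (hω : ∀ i q, 0 ≤ ω i q) {N : ℕ} {J : X → ℝ} (hJ : ∀ q, 0 < J q)
    (hs : Sm J) (h : ∀ N, FB e ω N (fun (_ : P) => J) (fun (_ : P) => J)) : ∀ s : ℝ,
    FB e ω N (fun (_ : P) q => J q ^ s) (fun (_ : P) q => J q ^ s) := by
  have hsm : ∀ s : ℝ, Sm (fun q => J q ^ s) := fun s =>
    ContDiff.rpow_const_of_ne hs (fun q => (hJ q).ne')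
  have hnn : ∀ (s : ℝ) q, 0 ≤ J q ^ s := fun s q => (Real.rpow_pos_of_pos (hJ q) s).le
  have hB : ∀ (s : ℝ) (p : P) q, ‖J q ^ s‖ ≤ 1 * J q ^ s := by
    intro s p q; rw [Real.norm_of_nonneg (hnn s q), one_mul]
  induction N with
  | zero => intro s; exact FB.of_bd zero_le_one (hB s)
  | succ N ih =>
    intro s
    refine FB.step hω (fun p q => hnn s q) zero_le_one (hB s) fun i => ?_
    have hd : DD (e i) (fun q => J q ^ s) = fun q => s • (J q ^ (s-1) • DD (e i) J q) := by
      funext q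
      have := ((hs.diff q).hasFDerivAt.rpow_const (p := s) (Or.inl (hJ q).ne'))
      simp only [DD]
      rw [this.fderiv]
      simp [mul_assoc]
    simp only [hd]
    have h1 := FB.smul hω (fun p q => hnn (s-1) q)
      (fun p q => mul_nonneg (hJ q).le (hω i q)) (fun _ => hsm (s-1)) (fun _ => hs.DD (e i))
      (ih (s-1)) ((h (N+1)).deriv i)
    have h2 := FB.csmul hω (fun _ => s)
      (fun p q => mul_nonneg (hnn (s-1) q) (mul_nonneg (hJ q).le (hω i q)))
      (fun _ => (hsm (s-1)).smul (hs.DD (e i))) h1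
    refine h2.mono hω (abs_nonneg s) fun p q => le_of_eq ?_
    have : J q ^ s = J q ^ (s-1) * J q := by
      rw [← Real.rpow_add_one (hJ q).ne']; simp
    rw [this]; ring

theorem exp_bd {s : ℝ} (hs : 0 ≤ s) : ∃ C, 0 ≤ C ∧ ∀ t : ℝ, 0 < t → Real.exp (-t) ≤ C * t ^ (-s) := by
  rcases hs.eq_or_lt with rfl | hs
  · exact ⟨1, zero_le_one, fun t ht => by simpa using ht.le⟩
  refine ⟨s ^ s, by positivity, fun t ht => ?_⟩
  have h1 : t / s ≤ Real.exp (t / s) := by linarith [Real.add_one_le_exp (t / s)]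
  have h2 : (t / s) ^ s ≤ Real.exp t := by
    calc _ ≤ (Real.exp (t / s)) ^ s := Real.rpow_le_rpow (by positivity) h1 hs.le
      _ = Real.exp t := by rw [← Real.exp_mul]; congr 1; field_simp
  rw [Real.div_rpow ht.le hs.le, div_le_iff₀ (by positivity)] at h2
  rw [Real.exp_neg, Real.rpow_neg ht.le, ← div_eq_mul_inv, le_div_iff₀ (by positivity),
    inv_mul_le_iff₀ (Real.exp_pos t)]
  exact h2

theorem Sm.exp {w : X → ℝ} (hw : Sm w) (ε : ℝ) : Sm (fun q => Real.exp (-(ε * w q))) :=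
  ContDiff.exp (ContDiff.neg (ContDiff.mul contDiff_const hw))

theorem DD_exp {w : X → ℝ} (hw : Sm w) (ε : ℝ) (v : X) :
    DD v (fun q => Real.exp (-(ε * w q))) =
      fun q => (-ε) • (DD v w q • Real.exp (-(ε * w q))) := by
  funext q
  have := (((hw.diff q).hasFDerivAt.const_mul ε).neg).exp
  simp only [DD]
  erw [this.fderiv]
  simp; ring

theorem FB.exp [Fintype ι] (hω : ∀ i q, 0 ≤ ω i q) {N : ℕ} {w : X → ℝ} (hw : ∀ q, 0 < w q)
    (hs : Sm w) (h : ∀ N, FB e ω N (fun (_ : P) => w) (fun (_ : P) => w)) (ε : P → ℝ)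
    (hε : ∀ p, 0 < ε p) : ∀ s : ℝ, 0 ≤ s →
    FB e ω N (fun p q => (ε p * w q) ^ (-s)) (fun p q => Real.exp (-(ε p * w q))) := by
  have hpos : ∀ p q, 0 < ε p * w q := fun p q => mul_pos (hε p) (hw q)
  have hnn : ∀ (s : ℝ) p q, 0 ≤ (ε p * w q) ^ s :=
    fun s p q => (Real.rpow_pos_of_pos (hpos p q) s).le
  have hB : ∀ s : ℝ, 0 ≤ s → ∃ C, 0 ≤ C ∧ ∀ p q,
      ‖Real.exp (-(ε p * w q))‖ ≤ C * (ε p * w q) ^ (-s) := by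
    intro s hs
    obtain ⟨C, hC, h⟩ := exp_bd hs
    refine ⟨C, hC, fun p q => ?_⟩
    rw [Real.norm_of_nonneg (Real.exp_pos _).le]
    exact h _ (hpos p q)
  induction N with
  | zero => intro s hs; obtain ⟨C, hC, h⟩ := hB s hs; exact FB.of_bd hC h
  | succ N ih =>
    intro s hs'
    obtain ⟨C, hC, hb⟩ := hB s hs'
    refine FB.step hω (fun p q => hnn _ p q) hC hb fun i => ?_
    simp only [DD_exp hs]
    have h1 := FB.smul hω (fun p q => mul_nonneg (hw q).le (hω i q))
      (fun p q => hnn (-(s+1)) p q) (fun _ => hs.DD (e i)) (fun p => hs.exp (ε p))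
      ((h (N+1)).deriv i) (ih (s+1) (by linarith))
    have h2 := FB.csmul hω (fun p => -ε p)
      (fun p q => mul_nonneg (mul_nonneg (hw q).le (hω i q)) (hnn (-(s+1)) p q))
      (fun p => (hs.DD (e i)).smul (hs.exp (ε p))) h1
    refine h2.mono1 hω fun p q => le_of_eq ?_
    have : (ε p * w q) ^ (-s) = (ε p * w q) ^ (-(s+1)) * (ε p * w q) := by
      rw [← Real.rpow_add_one (hpos p q).ne']; congr 1; ring
    rw [this, abs_neg, abs_of_pos (hε p)]; ring

theorem psi_bd {δ t : ℝ} (h0 : 0 ≤ δ) (h1 : δ ≤ 1) (ht : 0 < t) :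
    ‖1 - Real.exp (-t)‖ ≤ 1 * t ^ δ := by
  have ha : Real.exp (-t) ≤ 1 := by simpa using ht.le
  rw [Real.norm_of_nonneg (by linarith), one_mul]
  rcases le_total t 1 with h | h
  · have : t ≤ t ^ δ := by
      simpa using Real.rpow_le_rpow_of_exponent_ge ht h h1
    linarith [Real.add_one_le_exp (-t)]
  · linarith [Real.one_le_rpow h h0, Real.exp_pos (-t)]

theorem FB.psi [Fintype ι] (hω : ∀ i q, 0 ≤ ω i q) {N : ℕ} {w : X → ℝ} (hw : ∀ q, 0 < w q)
    (hs : Sm w) (h : ∀ N, FB e ω N (fun (_ : P) => w) (fun (_ : P) => w)) (ε : P → ℝ)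
    (hε : ∀ p, 0 < ε p) {δ : ℝ} (h0 : 0 ≤ δ) (h1 : δ ≤ 1) :
    FB e ω N (fun p q => (ε p * w q) ^ δ) (fun p q => 1 - Real.exp (-(ε p * w q))) := by
  have hpos : ∀ p q, 0 < ε p * w q := fun p q => mul_pos (hε p) (hw q)
  have hnn : ∀ (s : ℝ) p q, 0 ≤ (ε p * w q) ^ s :=
    fun s p q => (Real.rpow_pos_of_pos (hpos p q) s).le
  have hb := fun p q => psi_bd h0 h1 (hpos p q)
  cases N with
  | zero => exact FB.of_bd zero_le_one hb
  | succ N =>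
    refine FB.step hω (fun p q => hnn _ p q) zero_le_one hb fun i => ?_
    have hd : ∀ p, DD (e i) (fun q => 1 - Real.exp (-(ε p * w q))) =
      fun q => (ε p) • (DD (e i) w q • Real.exp (-(ε p * w q))) := by
      intro p
      have h3 := DD_exp hs (ε p) (e i)
      funext q
      have h4 := congrFun h3 q
      simp only [DD] at h4 ⊢
      rw [fderiv_const_sub]
      simp only [neg_apply, h4, neg_smul, neg_neg]
    simp only [hd]
    have h1 := FB.smul hω (fun p q => mul_nonneg (hw q).le (hω i q))
      (fun p q => hnn (-(1-δ)) p q) (fun _ => hs.DD (e i)) (fun p => hs.exp (ε p))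
      ((h (N+1)).deriv i) (FB.exp hω hw hs h ε hε (1-δ) (by linarith))
    have h2 := FB.csmul hω (fun p => ε p)
      (fun p q => mul_nonneg (mul_nonneg (hw q).le (hω i q)) (hnn (-(1-δ)) p q))
      (fun p => (hs.DD (e i)).smul (hs.exp (ε p))) h1
    refine h2.mono1 hω fun p q => le_of_eq ?_
    have : (ε p * w q) ^ δ = (ε p * w q) ^ (-(1-δ)) * (ε p * w q) := by
      rw [← Real.rpow_add_one (hpos p q).ne']; congr 1; ring
    rw [this, abs_of_pos (hε p)]; ring

/-- infinite sums -/
theorem FBC.tsum [Fintype ι] [CompleteSpace E] (c : ι → X →L[ℝ] ℝ)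
    (hc : ∀ q, q = ∑ i, c i q • e i)
    (hω : ∀ i q, 0 ≤ ω i q) (hω1 : ∀ i q, ω i q ≤ 1) {u : ℕ → ℝ} (hu : Summable u)
    (hu0 : ∀ j, 0 ≤ u j) {N : ℕ} : ∀ {ν : X → ℝ} {g : ℕ → X → E}, (∀ q, 0 ≤ ν q) →
    (∀ q, ν q ≤ 1) → (∀ j, Sm (g j)) → (∀ j, FBC e ω (u j) N (fun _ : Unit => ν) (fun _ => g j)) →
    ContDiff ℝ N (fun q => ∑' j, g j q) ∧
    FBC e ω (∑' j, u j) N (fun _ : Unit => ν) (fun _ q => ∑' j, g j q) := by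
  have hB : ∀ {N : ℕ} {ν : X → ℝ} {g : ℕ → X → E}, 
    (∀ j, FBC e ω (u j) N (fun _ : Unit => ν) (fun _ => g j)) → 
      ∀ q, ‖∑' j, g j q‖ ≤ (∑' j, u j) * ν q := by
    intro N ν g h q
    exact tsum_of_norm_bounded (hu.hasSum.mul_right (ν q)) fun j => (h j).bd () q
  have hB1 : ∀ {N : ℕ} {ν : X → ℝ} {g : ℕ → X → E}, (∀ q, ν q ≤ 1) →
    (∀ j, FBC e ω (u j) N (fun _ : Unit => ν) (fun _ => g j)) → 
      ∀ j q, ‖g j q‖ ≤ u j := by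
    intro N ν g h1 h j q
    exact ((h j).bd () q).trans (mul_le_of_le_one_right (hu0 j) (h1 q))
  induction N with
  | zero =>
    intro ν g hν hν1 hg h
    refine ⟨?_, fun _ => hB h⟩
    rw [Nat.cast_zero, contDiff_zero]
    exact continuous_tsum (fun j => (hg j).diff.continuous) hu (hB1 hν1 h)
  | succ N ih =>
    intro ν g hν hν1 hg h
    have hν' : ∀ i q, 0 ≤ ν q * ω i q := fun i q => mul_nonneg (hν q) (hω i q)
    have hν1' : ∀ i q, ν q * ω i q ≤ 1 := fun i q => mul_le_one₀ (hν1 q) (hω i q) (hω1 i q)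
    have IH := fun i => ih (hν' i) (hν1' i) (fun j => (hg j).DD (e i)) (fun j => (h j).2 i)
    let T : ι → E →L[ℝ] X →L[ℝ] E := fun i =>
      (ContinuousLinearMap.smulRightL ℝ X E) (c i)
    have hrep : ∀ (L : X →L[ℝ] E), L = ∑ i, T i (L (e i)) := by
      intro L
      ext v
      conv_lhs => rw [hc v]
      simp [T]
    have hDb : ∀ j q, ‖fderiv ℝ (g j) q‖ ≤ (∑ i, ‖T i‖) * u j := by
      intro j q
      rw [hrep (fderiv ℝ (g j) q), Finset.sum_mul]
      refine (norm_sum_le _ _).trans (Finset.sum_le_sum fun i _ => ?_)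
      refine ((T i).le_opNorm _).trans (mul_le_mul_of_nonneg_left ?_ (norm_nonneg _))
      exact hB1 (hν1' i) (fun j => (h j).2 i) j q
    have hsum0 : Summable fun j => g j 0 :=
      Summable.of_norm_bounded hu fun j => hB1 hν1 h j 0
    have hHas : ∀ q, HasFDerivAt (fun q => ∑' j, g j q) (∑' j, fderiv ℝ (g j) q) q := fun q =>
      hasFDerivAt_tsum (hu.mul_left _) (fun j q => ((hg j).diff q).hasFDerivAt) hDb hsum0 q
    have hDD : ∀ i, DD (e i) (fun q => ∑' j, g j q) = fun q => ∑' j, DD (e i) (g j) q := by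
      intro i
      funext q
      simp only [DD]
      rw [(hHas q).fderiv]
      have hsq : Summable fun j => fderiv ℝ (g j) q :=
        Summable.of_norm_bounded (hu.mul_left _) fun j => hDb j q
      exact (ContinuousLinearMap.apply ℝ E (e i)).map_tsum hsq
    refine ⟨?_, fun _ => hB h, fun i => ?_⟩
    · have : ((N + 1 : ℕ) : WithTop ℕ∞) = (N : WithTop ℕ∞) + 1 := by push_cast; rfl
      rw [this, contDiff_succ_iff_fderiv]
      refine ⟨fun q => (hHas q).differentiableAt, by simp, ?_⟩
      have hf : fderiv ℝ (fun q => ∑' j, g j q) =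
          fun q => ∑ i, T i (∑' j, DD (e i) (g j) q) := by
        funext q
        rw [hrep (fderiv ℝ (fun q => ∑' j, g j q) q)]
        refine Finset.sum_congr rfl fun i _ => ?_
        exact congrArg (T i) (congrFun (hDD i) q)
      rw [hf]
      exact ContDiff.sum fun i _ => (T i).contDiff.comp (IH i).1
    · simp only [hDD]
      exact (IH i).2

end gen
section conn

variable {n : ℕ} {E : Type*} [NormedAddCommGroup E] [NormedSpace ℝ E]

/-- coordinate directions -/
def ee : Fin n ⊕ Fin n → (Fin n → ℝ) × (Fin n → ℝ)
  | Sum.inl i => (Pi.single i 1, 0)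
  | Sum.inr i => (0, Pi.single i 1)

def cc : Fin n ⊕ Fin n → ((Fin n → ℝ) × (Fin n → ℝ)) →L[ℝ] ℝ
  | Sum.inl i => (ContinuousLinearMap.proj i).comp (ContinuousLinearMap.fst ℝ _ _)
  | Sum.inr i => (ContinuousLinearMap.proj i).comp (ContinuousLinearMap.snd ℝ _ _)

theorem cc_rep (q : (Fin n → ℝ) × (Fin n → ℝ)) : q = ∑ i, cc i q • ee i := by
  rw [Fintype.sum_sum_type]
  ext j
  · simp [cc, ee, Prod.fst_sum, Finset.sum_apply, Pi.single_apply]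
  · simp [cc, ee, Prod.snd_sum, Finset.sum_apply, Pi.single_apply]

def ww (σ : ℝ) : Fin n ⊕ Fin n → (Fin n → ℝ) × (Fin n → ℝ) → ℝ
  | Sum.inl _ => fun q => jb q.1 ^ (-σ)
  | Sum.inr _ => fun q => jb q.2 ^ (-1 : ℝ)

def mu (σ l m : ℝ) (q : (Fin n → ℝ) × (Fin n → ℝ)) : ℝ := jb q.1 ^ (σ * l) * jb q.2 ^ m

theorem one_le_jb (v : Fin n → ℝ) : 1 ≤ jb v := by
  unfold jb
  rw [Real.one_le_sqrt]
  have : 0 ≤ ∑ i, (v i) ^ 2 := Finset.sum_nonneg fun i _ => sq_nonneg _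
  linarith

theorem jb_pos (v : Fin n → ℝ) : 0 < jb v := lt_of_lt_of_le one_pos (one_le_jb v)

theorem ww_nonneg (σ : ℝ) (i : Fin n ⊕ Fin n) (q) : 0 ≤ ww σ i q := by
  cases i <;> exact (Real.rpow_pos_of_pos (jb_pos _) _).le

theorem ww_le_one {σ : ℝ} (hσ : 0 ≤ σ) (i : Fin n ⊕ Fin n) (q) : ww σ i q ≤ 1 := by
  cases i
  · exact Real.rpow_le_one_of_one_le_of_nonpos (one_le_jb _) (by linarith)
  · exact Real.rpow_le_one_of_one_le_of_nonpos (one_le_jb _) (by linarith)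

theorem mu_pos (σ l m : ℝ) (q : (Fin n → ℝ) × (Fin n → ℝ)) : 0 < mu σ l m q :=
  mul_pos (Real.rpow_pos_of_pos (jb_pos _) _) (Real.rpow_pos_of_pos (jb_pos _) _)

theorem mu_mono {σ l m l' m' : ℝ} (hσ : 0 ≤ σ) (hl : l ≤ l') (hm : m ≤ m')
    (q : (Fin n → ℝ) × (Fin n → ℝ)) : mu σ l m q ≤ mu σ l' m' q :=
  mul_le_mul (Real.rpow_le_rpow_of_exponent_le (one_le_jb _) (mul_le_mul_of_nonneg_left hl hσ))
    (Real.rpow_le_rpow_of_exponent_le (one_le_jb _) hm)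
    (Real.rpow_pos_of_pos (jb_pos _) _).le (Real.rpow_pos_of_pos (jb_pos _) _).le

theorem mu_mul (σ l m l' m' : ℝ) (q : (Fin n → ℝ) × (Fin n → ℝ)) :
    mu σ l m q * mu σ l' m' q = mu σ (l + l') (m + m') q := by
  simp only [mu, mul_add, Real.rpow_add (jb_pos _)]; ring

theorem mu_rpow (σ l m s : ℝ) (q : (Fin n → ℝ) × (Fin n → ℝ)) :
    mu σ l m q ^ s = mu σ (l * s) (m * s) q := by
  simp only [mu]
  rw [Real.mul_rpow (Real.rpow_pos_of_pos (jb_pos _) _).le (Real.rpow_pos_of_pos (jb_pos _) _).le,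
    ← Real.rpow_mul (jb_pos _).le, ← Real.rpow_mul (jb_pos _).le]
  simp only [mul_assoc]

theorem mu_zero (σ : ℝ) (q : (Fin n → ℝ) × (Fin n → ℝ)) : mu σ 0 0 q = 1 := by simp [mu]

theorem mu_inl (σ l m : ℝ) (i : Fin n) (q : (Fin n → ℝ) × (Fin n → ℝ)) :
    mu σ l m q * ww σ (Sum.inl i) q = mu σ (l - 1) m q := by
  have : ww σ (Sum.inl i) q = mu σ (-1) 0 q := by simp [mu, ww]
  rw [this, mu_mul]; congr 1; simp

theorem mu_inr (σ l m : ℝ) (i : Fin n) (q : (Fin n → ℝ) × (Fin n → ℝ)) :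
    mu σ l m q * ww σ (Sum.inr i) q = mu σ l (m - 1) q := by
  have : ww σ (Sum.inr i) q = mu σ 0 (-1) q := by simp [mu, ww]
  rw [this, mu_mul]; congr 1; simp

/-- folded derivatives on the product space -/
def PF {X : Type*} [NormedAddCommGroup X] [NormedSpace ℝ X] (v : Fin n → X) (L : List (Fin n))
    (α : Fin n → ℕ) (f : X → E) : X → E :=
  L.foldr (fun i g => (DD (v i))^[α i] g) f

theorem Sm.iter {X : Type*} [NormedAddCommGroup X] [NormedSpace ℝ X] {f : X → E} (hf : Sm f)
    (v : X) (k : ℕ) : Sm ((_root_.DD v)^[k] f) := by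
  induction k with
  | zero => exact hf
  | succ k ih => rw [Function.iterate_succ_apply']; exact ih.DD v

theorem Sm.PF {X : Type*} [NormedAddCommGroup X] [NormedSpace ℝ X] {f : X → E} (hf : Sm f)
    (v : Fin n → X) (L : List (Fin n)) (α : Fin n → ℕ) : Sm (_root_.PF v L α f) := by
  induction L with
  | nil => exact hf
  | cons i L ih => exact ih.iter _ _

theorem DD_iter_comm {X : Type*} [NormedAddCommGroup X] [NormedSpace ℝ X] {f : X → E} (hf : Sm f)
    (u v : X) (k : ℕ) : DD u ((DD v)^[k] f) = (DD v)^[k] (DD u f) := by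
  induction k with
  | zero => rfl
  | succ k ih =>
    rw [Function.iterate_succ_apply', Function.iterate_succ_apply', DD_comm (hf.iter v k), ih]

theorem DD_PF_comm {X : Type*} [NormedAddCommGroup X] [NormedSpace ℝ X] {f : X → E} (hf : Sm f)
    (u : X) (v : Fin n → X) (L : List (Fin n)) (α : Fin n → ℕ) :
    DD u (PF v L α f) = PF v L α (DD u f) := by
  induction L with
  | nil => rfl
  | cons i L ih =>
    show DD u ((DD (v i))^[α i] (PF v L α f)) = (DD (v i))^[α i] (PF v L α (DD u f))
    rw [DD_iter_comm (hf.PF v L α), ih]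

theorem PF_congr {X : Type*} [NormedAddCommGroup X] [NormedSpace ℝ X] (f : X → E)
    (v : Fin n → X) (L : List (Fin n)) (α β : Fin n → ℕ) (h : ∀ i ∈ L, α i = β i) :
    PF v L α f = PF v L β f := by
  induction L with
  | nil => rfl
  | cons i L ih =>
    show (DD (v i))^[α i] (PF v L α f) = (DD (v i))^[β i] (PF v L β f)
    rw [ih fun j hj => h j (by simp [hj]), h i (by simp)]

theorem DD_PF {X : Type*} [NormedAddCommGroup X] [NormedSpace ℝ X] {f : X → E} (hf : Sm f)
    (v : Fin n → X) (L : List (Fin n)) (hL : L.Nodup) (i : Fin n) (hi : i ∈ L) (α : Fin n → ℕ) :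
    DD (v i) (PF v L α f) = PF v L (α + Pi.single i 1) f := by
  induction L with
  | nil => simp at hi
  | cons j L ih =>
    rw [List.nodup_cons] at hL
    show DD (v i) ((DD (v j))^[α j] (PF v L α f)) =
      (DD (v j))^[(α + (Pi.single i 1 : Fin n → ℕ)) j] (PF v L (α + Pi.single i 1) f)
    by_cases hij : i = j
    · subst hij
      rw [PF_congr f v L (α + Pi.single i 1) α, ← Function.iterate_succ_apply' (DD (v i))]
      · simp
      · intro k hk
        have : k ≠ i := by rintro rfl; exact hL.1 hk
        simp [this]
    · have h1 : i ∈ L := by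
        rcases List.mem_cons.1 hi with h | h
        · exact absurd h hij
        · exact h
      rw [DD_iter_comm (hf.PF v L α), ih hL.2 h1]
      have : (α + (Pi.single i 1 : Fin n → ℕ)) j = α j := by simp [Ne.symm hij]
      rw [this]

/-- the full mixed derivative -/
def PP (α β : Fin n → ℕ) (f : (Fin n → ℝ) × (Fin n → ℝ) → E) : (Fin n → ℝ) × (Fin n → ℝ) → E :=
  PF (fun i => ee (Sum.inl i)) (List.finRange n) α
    (PF (fun i => ee (Sum.inr i)) (List.finRange n) β f)

theorem DD_PP_inl {f : (Fin n → ℝ) × (Fin n → ℝ) → E} (hf : Sm f) (α β : Fin n → ℕ) (i : Fin n) :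
    DD (ee (Sum.inl i)) (PP α β f) = PP (α + Pi.single i 1) β f :=
  DD_PF (hf.PF _ _ _) (fun i => ee (Sum.inl i)) _ (List.nodup_finRange n) i (List.mem_finRange i) α

theorem DD_PP_inr {f : (Fin n → ℝ) × (Fin n → ℝ) → E} (hf : Sm f) (α β : Fin n → ℕ) (i : Fin n) :
    DD (ee (Sum.inr i)) (PP α β f) = PP α (β + Pi.single i 1) f := by
  unfold PP
  rw [DD_PF_comm (hf.PF _ _ _)]
  congr 1
  exact DD_PF hf (fun i => ee (Sum.inr i)) _ (List.nodup_finRange n) i (List.mem_finRange i) β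

theorem pdm_slice1 {f : (Fin n → ℝ) × (Fin n → ℝ) → E} (hf : Sm f) (α : Fin n → ℕ)
    (y : Fin n → ℝ) : pdm α (fun x => f (x, y)) =
      fun x => PF (fun i => ee (Sum.inl i)) (List.finRange n) α f (x, y) := by
  have h1 : ∀ {g : (Fin n → ℝ) × (Fin n → ℝ) → E} (_ : Sm g) (i : Fin n),
      pd i (fun x => g (x, y)) = fun x => DD (ee (Sum.inl i)) g (x, y) := by
    intro g hg i
    funext x
    have h2 : HasFDerivAt (fun x : Fin n → ℝ => (x, y))
        (ContinuousLinearMap.inl ℝ (Fin n → ℝ) (Fin n → ℝ)) x := hasFDerivAt_prodMk_left x y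
    have h3 := (hg.diff (x, y)).hasFDerivAt.comp x h2
    have h4 : fderiv ℝ (fun x => g (x, y)) x = _ := h3.fderiv
    simp [pd, DD, ee, h4]
  have h2 : ∀ {g : (Fin n → ℝ) × (Fin n → ℝ) → E} (_ : Sm g) (i : Fin n) (k : ℕ),
      (pd i)^[k] (fun x => g (x, y)) = fun x => (DD (ee (Sum.inl i)))^[k] g (x, y) := by
    intro g hg i k
    induction k with
    | zero => rfl
    | succ k ih =>
      rw [Function.iterate_succ_apply', Function.iterate_succ_apply', ih, h1 (hg.iter _ k)]
  unfold pdm PF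
  induction List.finRange n with
  | nil => rfl
  | cons i L ih =>
    rw [List.foldr_cons, ih]
    exact h2 (hf.PF (fun i => ee (Sum.inl i)) L α) i (α i)

theorem pdm_slice2 {f : (Fin n → ℝ) × (Fin n → ℝ) → E} (hf : Sm f) (α : Fin n → ℕ)
    (x : Fin n → ℝ) : pdm α (fun y => f (x, y)) =
      fun y => PF (fun i => ee (Sum.inr i)) (List.finRange n) α f (x, y) := by
  have h1 : ∀ {g : (Fin n → ℝ) × (Fin n → ℝ) → E} (_ : Sm g) (i : Fin n),
      pd i (fun y => g (x, y)) = fun y => DD (ee (Sum.inr i)) g (x, y) := by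
    intro g hg i
    funext y
    have h2 : HasFDerivAt (fun y : Fin n → ℝ => (x, y))
        (ContinuousLinearMap.inr ℝ (Fin n → ℝ) (Fin n → ℝ)) y := hasFDerivAt_prodMk_right x y
    have h3 := (hg.diff (x, y)).hasFDerivAt.comp y h2
    have h4 : fderiv ℝ (fun y => g (x, y)) y = _ := h3.fderiv
    simp [pd, DD, ee, h4]
  have h2 : ∀ {g : (Fin n → ℝ) × (Fin n → ℝ) → E} (_ : Sm g) (i : Fin n) (k : ℕ),
      (pd i)^[k] (fun y => g (x, y)) = fun y => (DD (ee (Sum.inr i)))^[k] g (x, y) := by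
    intro g hg i k
    induction k with
    | zero => rfl
    | succ k ih =>
      rw [Function.iterate_succ_apply', Function.iterate_succ_apply', ih, h1 (hg.iter _ k)]
  unfold pdm PF
  induction List.finRange n with
  | nil => rfl
  | cons i L ih =>
    rw [List.foldr_cons, ih]
    exact h2 (hf.PF (fun i => ee (Sum.inr i)) L α) i (α i)

theorem pdm2_eq {a : (Fin n → ℝ) → (Fin n → ℝ) → E}
    (hf : Sm (fun q : (Fin n → ℝ) × (Fin n → ℝ) => a q.1 q.2)) (α β : Fin n → ℕ) (x y) :
    pdm2 α β a x y = PP α β (fun q => a q.1 q.2) (x, y) := by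
  unfold pdm2 PP
  have h := fun x' => pdm_slice2 hf β x'
  simp only at h
  have h' : (fun x' => pdm β (a x') y) = fun x' => PF (fun i => ee (Sum.inr i)) (List.finRange n) β
      (fun q : (Fin n → ℝ) × (Fin n → ℝ) => a q.1 q.2) (x', y) := by
    funext x'
    exact congrFun (h x') y
  rw [h', pdm_slice1 (hf.PF _ _ _) α y]

/-- reformulated symbol class -/
def GS (σ l m : ℝ) (f : (Fin n → ℝ) × (Fin n → ℝ) → E) : Prop :=
  ∀ N, FB ee (ww σ) N (fun _ : Unit => mu σ l m) (fun _ => f)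

theorem msize_add (α : Fin n → ℕ) (i : Fin n) : msize (α + Pi.single i 1) = msize α + 1 := by
  simp [msize, Finset.sum_add_distrib]

theorem GS_of_Ssym {σ l m : ℝ} {a : (Fin n → ℝ) → (Fin n → ℝ) → E} (h : Ssym σ l m a) :
    GS σ l m (fun q => a q.1 q.2) := by
  obtain ⟨hs, hb⟩ := h
  have key : ∀ N α β, FB ee (ww σ) N (fun _ : Unit => mu σ (l - msize α) (m - msize β))
      (fun _ => PP α β (fun q => a q.1 q.2)) := by
    have hbd : ∀ α β, ∃ C, 0 ≤ C ∧ ∀ (_ : Unit) q, ‖PP α β (fun q => a q.1 q.2) q‖ ≤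
        C * mu σ (l - msize α) (m - msize β) q := by
      intro α β
      obtain ⟨C, hC, h⟩ := hb α β
      refine ⟨C, hC.le, fun _ q => ?_⟩
      have := h q.1 q.2
      rw [pdm2_eq hs] at this
      simpa [mu, mul_assoc] using this
    intro N
    induction N with
    | zero =>
      intro α β
      obtain ⟨C, hC, h⟩ := hbd α β
      exact FB.of_bd hC h
    | succ N ih =>
      intro α β
      obtain ⟨C, hC, h⟩ := hbd α β
      refine FB.step (ww_nonneg σ) (fun _ q => (mu_pos _ _ _ q).le) hC h fun i => ?_
      cases i with
      | inl i =>
        simp only [DD_PP_inl hs, mu_inl]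
        have := ih (α + Pi.single i 1) β
        rw [msize_add] at this
        simpa [sub_sub] using this
      | inr i =>
        simp only [DD_PP_inr hs, mu_inr]
        have := ih α (β + Pi.single i 1)
        rw [msize_add] at this
        simpa [sub_sub] using this
  intro N
  have := key N 0 0
  have h0 : PP (0 : Fin n → ℕ) 0 (fun q : (Fin n → ℝ) × (Fin n → ℝ) => a q.1 q.2) =
      fun q => a q.1 q.2 := by
    have : ∀ (v : Fin n → (Fin n → ℝ) × (Fin n → ℝ)) (L : List (Fin n))
      (f : (Fin n → ℝ) × (Fin n → ℝ) → E), PF v L 0 f = f := by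
      intro v L f
      induction L with
      | nil => rfl
      | cons i L ih => exact ih
    simp [PP, this]
  rw [h0] at this
  simpa [msize] using this

theorem GS.inl {σ l m : ℝ} {f : (Fin n → ℝ) × (Fin n → ℝ) → E} (h : GS σ l m f) (i : Fin n) :
    GS σ (l - 1) m (DD (ee (Sum.inl i)) f) := by
  intro N
  have := (h (N+1)).deriv (Sum.inl i)
  simpa only [mu_inl] using this

theorem GS.inr {σ l m : ℝ} {f : (Fin n → ℝ) × (Fin n → ℝ) → E} (h : GS σ l m f) (i : Fin n) :
    GS σ l (m - 1) (DD (ee (Sum.inr i)) f) := by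
  intro N
  have := (h (N+1)).deriv (Sum.inr i)
  simpa only [mu_inr] using this

theorem GS.PF_inl {σ l m : ℝ} {f : (Fin n → ℝ) × (Fin n → ℝ) → E} (h : GS σ l m f)
    (L : List (Fin n)) (α : Fin n → ℕ) :
    GS σ (l - ((L.map α).sum : ℕ)) m (PF (fun i => ee (Sum.inl i)) L α f) := by
  induction L with
  | nil => simpa [PF] using h
  | cons i L ih =>
    have : ∀ k : ℕ, GS σ (l - ((L.map α).sum : ℕ) - k) m
        ((DD (ee (Sum.inl i)))^[k] (PF (fun i => ee (Sum.inl i)) L α f)) := by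
      intro k
      induction k with
      | zero => simpa using ih
      | succ k ih' =>
        rw [Function.iterate_succ_apply']
        have := ih'.inl i
        simpa [sub_sub, add_assoc] using this
    have h2 := this (α i)
    have e1 : l - (((i :: L).map α).sum : ℕ) = l - ((L.map α).sum : ℕ) - α i := by
      simp; ring
    rw [e1]
    exact h2

theorem GS.PF_inr {σ l m : ℝ} {f : (Fin n → ℝ) × (Fin n → ℝ) → E} (h : GS σ l m f)
    (L : List (Fin n)) (α : Fin n → ℕ) :
    GS σ l (m - ((L.map α).sum : ℕ)) (PF (fun i => ee (Sum.inr i)) L α f) := by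
  induction L with
  | nil => simpa [PF] using h
  | cons i L ih =>
    have : ∀ k : ℕ, GS σ l (m - ((L.map α).sum : ℕ) - k)
        ((DD (ee (Sum.inr i)))^[k] (PF (fun i => ee (Sum.inr i)) L α f)) := by
      intro k
      induction k with
      | zero => simpa using ih
      | succ k ih' =>
        rw [Function.iterate_succ_apply']
        have := ih'.inr i
        simpa [sub_sub, add_assoc] using this
    have h2 := this (α i)
    have e1 : m - (((i :: L).map α).sum : ℕ) = m - ((L.map α).sum : ℕ) - α i := by
      simp; ring
    rw [e1]
    exact h2

theorem Ssym_of_GS {σ l m : ℝ} {a : (Fin n → ℝ) → (Fin n → ℝ) → E}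
    (hs : Sm (fun q : (Fin n → ℝ) × (Fin n → ℝ) => a q.1 q.2))
    (h : GS σ l m (fun q => a q.1 q.2)) : Ssym σ l m a := by
  refine ⟨hs, fun α β => ?_⟩
  have hsum : ∀ α : Fin n → ℕ, ((List.finRange n).map α).sum = msize α := by
    intro α
    simp [msize, List.sum_ofFn, ← List.ofFn_eq_map]
  have h1 := ((h.PF_inr (List.finRange n) β).PF_inl (List.finRange n) α) 0
  rw [hsum, hsum] at h1
  obtain ⟨C, hC, h1⟩ := h1.bd
  refine ⟨C + 1, by positivity, fun x ϑ => ?_⟩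
  rw [pdm2_eq hs, mul_assoc]
  refine (h1 () (x, ϑ)).trans ?_
  exact mul_le_mul_of_nonneg_right (by linarith) (mu_pos _ _ _ _).le

/-- the weights are symbols -/
theorem FB_quad {X ι P : Type*} [NormedAddCommGroup X] [NormedSpace ℝ X] [Fintype ι]
    {e : ι → X} {ω : ι → X → ℝ}
    (hω : ∀ i q, 0 ≤ ω i q) (c : Fin n → X →L[ℝ] ℝ)
    (h : ∀ k i q, |c k (e i)| ≤ jb (fun k => c k q) * ω i q) (N : ℕ) (s : ℝ) :
    FB e ω N (fun (_ : P) q => jb (fun k => c k q) ^ s) (fun (_ : P) q => jb (fun k => c k q) ^ s)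
    ∧ Sm (fun q => jb (fun k => c k q) ^ s) := by
  have hpos : ∀ q, 0 < 1 + ∑ k, (c k q) ^ 2 := fun q => by
    have : 0 ≤ ∑ k, (c k q) ^ 2 := Finset.sum_nonneg fun i _ => sq_nonneg _
    linarith
  have hc : ∀ k, Sm (fun q => c k q) := fun k => (c k).contDiff
  have hj : ∀ q, jb (fun k => c k q) * jb (fun k => c k q) = 1 + ∑ k, (c k q) ^ 2 := fun q =>
    Real.mul_self_sqrt (hpos q).le
  have hck : ∀ k N, FB e ω N (fun (_ : P) q => jb (fun k => c k q)) (fun (_ : P) q => c k q) := by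
    intro k N
    have hb : ∀ (_ : P) q, ‖c k q‖ ≤ 1 * jb (fun k => c k q) := by
      intro _ q
      rw [one_mul, Real.norm_eq_abs]
      apply Real.abs_le_sqrt
      linarith [Finset.single_le_sum (s := Finset.univ) (f := fun k => (c k q)^2)
        (fun i _ => sq_nonneg _) (Finset.mem_univ k)]
    cases N with
    | zero => exact FB.of_bd zero_le_one hb
    | succ N =>
      refine FB.step hω (fun _ q => (jb_pos _).le) zero_le_one hb fun i => ?_
      have hd : DD (e i) (fun q => c k q) = fun _ => c k (e i) := by
        funext q; simp [DD]
      simp only [hd]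
      exact FB.const hω (fun _ => c k (e i)) fun _ q => h k i q
  have hQ : ∀ N, FB e ω N (fun (_ : P) q => 1 + ∑ k, (c k q) ^ 2)
      (fun (_ : P) q => 1 + ∑ k, (c k q) ^ 2) := by
    intro N
    have hQnn : ∀ (_ : P) q, 0 ≤ 1 + ∑ k, (c k q) ^ 2 := fun _ q => (hpos q).le
    have hsq : ∀ k, Sm (fun q => (c k q) ^ 2) := fun k => ContDiff.pow (hc k) 2
    refine FB.add (F := fun _ _ => (1 : ℝ)) (G := fun _ q => ∑ k, (c k q) ^ 2)
      (fun _ => Sm.const _) (fun _ => Sm.sum _ fun k _ => hsq k) ?_ ?_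
    · refine FB.const hω (fun _ => (1 : ℝ)) fun _ q => ?_
      have : 0 ≤ ∑ k, (c k q) ^ 2 := Finset.sum_nonneg fun i _ => sq_nonneg _
      simpa using this
    · refine FB.sum hω _ hQnn (F := fun k _ q => (c k q) ^ 2) (fun k _ => hsq k) fun k _ => ?_
      have := FB.smul hω (fun _ q => (jb_pos _).le) (fun _ q => (jb_pos _).le)
        (fun _ => hc k) (fun _ => hc k) (hck k N) (hck k N)
      simp only [hj, smul_eq_mul, ← sq] at this
      exact this
  have hQs : Sm (fun q => 1 + ∑ k, (c k q) ^ 2) :=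
    (Sm.const 1).add (Sm.sum _ fun k _ => ContDiff.pow (hc k) 2)
  have e1 : ∀ q, jb (fun k => c k q) ^ s = (1 + ∑ k, (c k q) ^ 2) ^ (s / 2) := by
    intro q
    unfold jb
    rw [Real.sqrt_eq_rpow, ← Real.rpow_mul (hpos q).le]; congr 1; ring
  simp only [e1]
  exact ⟨FB.rpow hω hpos hQs hQ (s/2), ContDiff.rpow_const_of_ne hQs (fun q => (hpos q).ne')⟩

theorem FB_w {P : Type*} {σ : ℝ} (h1 : σ ≤ 1) (N : ℕ) :
    FB ee (ww σ) N (fun _ : P => mu (n := n) σ 1 1) (fun _ => mu σ 1 1) ∧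
    Sm (mu (n := n) σ 1 1) := by
  have A := FB_quad (P := P) (e := ee) (ww_nonneg (n := n) σ) (fun i => cc (Sum.inl i)) (by
    intro k i q
    have hq : (fun k => cc (Sum.inl k) q) = q.1 := rfl
    rw [hq]
    cases i with
    | inl i =>
      have : jb q.1 * ww σ (Sum.inl i) q = jb q.1 ^ (1 - σ) := by
        simp only [ww]
        rw [sub_eq_add_neg, Real.rpow_add (jb_pos _), Real.rpow_one]
      rw [this]
      refine le_trans ?_ (Real.one_le_rpow (one_le_jb _) (by linarith))
      simp only [cc, ee, ContinuousLinearMap.comp_apply, ContinuousLinearMap.coe_fst',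
        ContinuousLinearMap.proj_apply, Pi.single_apply]
      split_ifs <;> simp
    | inr i =>
      have := mul_nonneg (jb_pos q.1).le (ww_nonneg σ (Sum.inr i) q)
      simpa [cc, ee] using this) N σ
  have B := FB_quad (P := P) (e := ee) (ww_nonneg (n := n) σ) (fun i => cc (Sum.inr i)) (by
    intro k i q
    have hq : (fun k => cc (Sum.inr k) q) = q.2 := rfl
    rw [hq]
    cases i with
    | inr i =>
      have : jb q.2 * ww σ (Sum.inr i) q = 1 := by
        simp only [ww]
        rw [Real.rpow_neg_one, mul_inv_cancel₀ (jb_pos _).ne']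
      rw [this]
      simp only [cc, ee, ContinuousLinearMap.comp_apply, ContinuousLinearMap.coe_snd',
        ContinuousLinearMap.proj_apply, Pi.single_apply]
      split_ifs <;> simp
    | inl i =>
      have := mul_nonneg (jb_pos q.2).le (ww_nonneg σ (Sum.inl i) q)
      simpa [cc, ee] using this) N 1
  have e1 : mu (n := n) σ 1 1 = fun q => jb (fun k => cc (Sum.inl k) q) ^ σ *
      jb (fun k => cc (Sum.inr k) q) ^ (1 : ℝ) := by
    funext q; simp only [mu, mul_one]; rfl
  rw [e1]
  exact ⟨FB.smul (ww_nonneg σ) (fun _ q => (Real.rpow_pos_of_pos (jb_pos _) _).le)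
    (fun _ q => (Real.rpow_pos_of_pos (jb_pos _) _).le) (fun _ => A.2) (fun _ => B.2) A.1 B.1,
    A.2.smul B.2⟩

end conn
section mainsec

theorem FBC.comap {X : Type*} [NormedAddCommGroup X] [NormedSpace ℝ X]
    {E : Type*} [NormedAddCommGroup E] [NormedSpace ℝ E] {ι P P' : Type*}
    {e : ι → X} {ω : ι → X → ℝ} {C : ℝ} {N : ℕ} (g : P' → P) :
    ∀ {μ : P → X → ℝ} {F : P → X → E}, FBC e ω C N μ F →
      FBC e ω C N (fun p => μ (g p)) (fun p => F (g p)) := by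
  induction N with
  | zero => intro μ F h p q; exact h (g p) q
  | succ N ih => intro μ F h; exact ⟨fun p q => h.1 (g p) q, fun i => ih (h.2 i)⟩

variable {n : ℕ} {E : Type*} [NormedAddCommGroup E] [NormedSpace ℝ E]

theorem GS.mono {σ l m l' m' : ℝ} (hσ : 0 ≤ σ) (hl : l ≤ l') (hm : m ≤ m')
    {f : (Fin n → ℝ) × (Fin n → ℝ) → E} (h : GS σ l m f) : GS σ l' m' f := fun N =>
  (h N).mono1 (ww_nonneg σ) fun _ q => mu_mono hσ hl hm q

theorem GS.sub {σ l m : ℝ} {f g : (Fin n → ℝ) × (Fin n → ℝ) → E} (hf : Sm f) (hg : Sm g)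
    (h : GS σ l m f) (h' : GS σ l m g) : GS σ l m (fun q => f q - g q) := fun N =>
  FB.sub (ww_nonneg σ) (fun _ q => (mu_pos _ _ _ q).le) (fun _ => hf) (fun _ => hg) (h N) (h' N)

theorem Sm.sub {X : Type*} [NormedAddCommGroup X] [NormedSpace ℝ X] {f g : X → E}
    (hf : Sm f) (hg : Sm g) : Sm (fun q => f q - g q) := ContDiff.sub hf hg

theorem GS.rem {σ l m : ℝ} (hσ : 0 ≤ σ) (hσ1 : σ ≤ 1) {f : (Fin n → ℝ) × (Fin n → ℝ) → E}
    (hf : Sm f) (h : GS σ l m f) {ε : ℝ} (hε : 0 < ε) (l' m' : ℝ) :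
    GS σ l' m' (fun q => Real.exp (-(ε * mu σ 1 1 q)) • f q) := by
  intro N
  set s : ℝ := max 0 (max (l - l') (m - m')) with hs
  have hs0 : 0 ≤ s := le_max_left _ _
  have hsl : l - l' ≤ s := (le_max_left _ _).trans (le_max_right _ _)
  have hsm : m - m' ≤ s := (le_max_right _ _).trans (le_max_right _ _)
  have h1 := FB.exp (P := Unit) (ww_nonneg (n := n) σ) (N := N) (mu_pos σ 1 1) (FB_w (P := Unit) hσ1 0).2
    (fun N => (FB_w hσ1 N).1) (fun _ => ε) (fun _ => hε) s hs0
  have h2 := FB.smul (ww_nonneg σ)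
    (fun _ q => (Real.rpow_pos_of_pos (mul_pos hε (mu_pos σ 1 1 q)) _).le)
    (fun _ q => (mu_pos _ _ _ q).le) (fun _ => (FB_w (P := Unit) hσ1 0).2.exp ε) (fun _ => hf)
    h1 (h N)
  refine h2.mono (ww_nonneg σ) (K := ε ^ (-s)) (Real.rpow_pos_of_pos hε _).le fun _ q => ?_
  rw [Real.mul_rpow hε.le (mu_pos _ _ _ _).le, mu_rpow, mul_assoc, mu_mul]
  refine mul_le_mul_of_nonneg_left ?_ (Real.rpow_pos_of_pos hε _).le
  exact mu_mono hσ (by linarith) (by linarith) q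

theorem GS.small {σ l m l' m' : ℝ} (hσ : 0 ≤ σ) (hσ1 : σ ≤ 1)
    {f : (Fin n → ℝ) × (Fin n → ℝ) → E}
    (hf : Sm f) (h : GS σ l m f) (hl : l < l') (hm : m < m') (N : ℕ) {η : ℝ} (hη : 0 < η) :
    ∃ ε, 0 < ε ∧ FBC ee (ww σ) η N (fun _ : Unit => mu σ l' m')
      (fun _ q => (1 - Real.exp (-(ε * mu σ 1 1 q))) • f q) := by
  set δ : ℝ := min 1 (min (l' - l) (m' - m)) with hδ
  have hδ0 : 0 < δ := lt_min one_pos (lt_min (by linarith) (by linarith))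
  have hδ1 : δ ≤ 1 := min_le_left _ _
  have hδl : δ ≤ l' - l := (min_le_right _ _).trans (min_le_left _ _)
  have hδm : δ ≤ m' - m := (min_le_right _ _).trans (min_le_right _ _)
  have hw := (FB_w (n := n) (P := Unit) hσ1 0).2
  have h1 := FB.psi (P := Set.Ioi (0 : ℝ)) (ww_nonneg (n := n) σ) (N := N) (mu_pos σ 1 1) hw
    (fun N => (FB_w hσ1 N).1) (fun p => p.1) (fun p => p.2) hδ0.le hδ1
  have hfP : FB ee (ww σ) N (fun _ : Set.Ioi (0 : ℝ) => mu σ l m) (fun _ => f) := by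
    obtain ⟨C, hC, h⟩ := h N
    exact ⟨C, hC, h.comap (fun _ => ())⟩
  obtain ⟨C, hC, h2⟩ := FB.smul (ww_nonneg σ)
    (fun p q => (Real.rpow_pos_of_pos (mul_pos p.2 (mu_pos σ 1 1 q)) _).le)
    (fun _ q => (mu_pos _ _ _ q).le) (fun p => (Sm.const 1).sub (hw.exp p.1)) (fun _ => hf)
    h1 hfP
  have hε : 0 < (η / (C + 1)) ^ (1 / δ) := by positivity
  refine ⟨_, hε, ?_⟩
  refine (h2.comap (fun _ : Unit => (⟨_, hε⟩ : Set.Ioi (0 : ℝ)))).mono (ww_nonneg σ) ?_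
  intro _ q
  simp only
  rw [Real.mul_rpow hε.le (mu_pos _ _ _ _).le, ← Real.rpow_mul (by positivity),
    one_div_mul_cancel hδ0.ne', Real.rpow_one, mu_rpow, mul_assoc, mu_mul, ← mul_assoc]
  have h3 : C * (η / (C + 1)) ≤ η := by
    rw [mul_div_assoc', div_le_iff₀ (by positivity)]
    nlinarith
  exact mul_le_mul h3 (mu_mono hσ (by linarith) (by linarith) q) (mu_pos _ _ _ _).le hη.le

theorem main7 [FiniteDimensional ℝ E]
    (σ : ℝ) (hσ : σ ∈ Set.Icc (0 : ℝ) 1)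
    (l m : ℕ → ℝ) (hl : StrictAnti l) (hm : StrictAnti m)
    (hl' : Filter.Tendsto l Filter.atTop Filter.atBot)
    (hm' : Filter.Tendsto m Filter.atTop Filter.atBot)
    (a : ℕ → (Fin n → ℝ) → (Fin n → ℝ) → E)
    (ha : ∀ j, Ssym σ (l j) (m j) (a j)) :
    (∃ A : (Fin n → ℝ) → (Fin n → ℝ) → E, ∀ k : ℕ,
      Ssym σ (l k) (m k) (fun x ϑ => A x ϑ - ∑ j ∈ Finset.range k, a j x ϑ)) ∧
    (∀ A A' : (Fin n → ℝ) → (Fin n → ℝ) → E,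
      (∀ k : ℕ, Ssym σ (l k) (m k) (fun x ϑ => A x ϑ - ∑ j ∈ Finset.range k, a j x ϑ)) →
      (∀ k : ℕ, Ssym σ (l k) (m k) (fun x ϑ => A' x ϑ - ∑ j ∈ Finset.range k, a j x ϑ)) →
      ∀ l' m' : ℝ, Ssym σ l' m' (fun x ϑ => A x ϑ - A' x ϑ)) := by
  obtain ⟨h0, h1⟩ := hσ
  have : CompleteSpace E := FiniteDimensional.complete ℝ E
  refine ⟨?_, ?_⟩
  · set f : ℕ → (Fin n → ℝ) × (Fin n → ℝ) → E := fun j q => a j q.1 q.2 with hfdef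
    have hf : ∀ j, Sm (f j) := fun j => (ha j).1
    have hG : ∀ j, GS σ (l j) (m j) (f j) := fun j => GS_of_Ssym (ha j)
    have hw := (FB_w (n := n) (P := Unit) h1 0).2
    have hη : ∀ j : ℕ, (0 : ℝ) < (1 / 2) ^ j := fun j => by positivity
    choose ε hε hsmall using fun j : ℕ => (hG (j + 1)).small h0 h1 (hf (j + 1))
      (hl (Nat.lt_succ_self j)) (hm (Nat.lt_succ_self j)) j (hη j)
    set b : ℕ → (Fin n → ℝ) × (Fin n → ℝ) → E :=
      fun j q => (1 - Real.exp (-(ε j * mu σ 1 1 q))) • f (j + 1) q with hbdef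
    set r : ℕ → (Fin n → ℝ) × (Fin n → ℝ) → E :=
      fun j q => Real.exp (-(ε j * mu σ 1 1 q)) • f (j + 1) q with hrdef
    have hb : ∀ j, Sm (b j) := fun j => ((Sm.const 1).sub (hw.exp _)).smul (hf _)
    have hr : ∀ j, Sm (r j) := fun j => (hw.exp _).smul (hf _)
    have hbr : ∀ j q, b j q = f (j + 1) q - r j q := fun j q => by
      simp only [hbdef, hrdef, sub_smul, one_smul]
    have hrG : ∀ j l' m', GS σ l' m' (r j) := fun j l' m' => (hG (j + 1)).rem h0 h1 (hf _) (hε j) l' m'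
    have hbG : ∀ j, GS σ (l (j + 1)) (m (j + 1)) (b j) := fun j => by
      have : b j = fun q => f (j + 1) q - r j q := funext (hbr j)
      rw [this]
      exact (hG (j + 1)).sub (hf _) (hr _) (hrG j _ _)
    have hgeo : Summable fun j : ℕ => ((1 : ℝ) / 2) ^ j := summable_geometric_two
    obtain ⟨K0, hK0⟩ := Filter.eventually_atTop.1
      ((hl'.eventually_le_atBot 0).and (hm'.eventually_le_atBot 0))
    -- tails
    have hT : ∀ N K, N ≤ K → K0 ≤ K → ContDiff ℝ N (fun q => ∑' j, b (j + K) q) ∧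
        FB ee (ww σ) N (fun _ : Unit => mu σ (l K) (m K)) (fun _ q => ∑' j, b (j + K) q) := by
      intro N K hNK hK
      have := FBC.tsum (N := N) cc cc_rep (ww_nonneg σ) (ww_le_one h0) hgeo
        (fun j => (hη j).le) (ν := mu (n := n) σ (l K) (m K)) (g := fun j => b (j + K))
        (fun q => (mu_pos _ _ _ q).le)
        (fun q => (mu_mono h0 (hK0 K hK).1 (hK0 K hK).2 q).trans (mu_zero σ q).le)
        (fun j => hb _) (fun j => by
          refine ((hsmall (j + K)).lower_le (by omega)).mono (ww_nonneg σ) fun _ q => ?_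
          refine mul_le_mul ?_ (mu_mono h0 (hl.antitone (by omega)) (hm.antitone (by omega)) q)
            (mu_pos _ _ _ q).le (hη j).le
          exact pow_le_pow_of_le_one (by norm_num) (by norm_num) (by omega))
      exact ⟨this.1, _, tsum_nonneg fun j => (hη j).le, this.2⟩
    have hsumm : ∀ q, Summable fun j => b j q := by
      intro q
      rw [← summable_nat_add_iff K0]
      refine Summable.of_norm_bounded hgeo fun j => ?_
      refine ((hsmall (j + K0)).bd () q).trans ?_
      have h3 : mu σ (l (j + K0)) (m (j + K0)) q ≤ 1 :=
        (mu_mono h0 (hK0 _ (by omega)).1 (hK0 _ (by omega)).2 q).trans (mu_zero σ q).le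
      refine (mul_le_of_le_one_right (hη _).le h3).trans ?_
      exact pow_le_pow_of_le_one (by norm_num) (by norm_num) (by omega)
    have hsplit : ∀ K q, ∑' j, b j q = ∑ j ∈ Finset.range K, b j q + ∑' j, b (j + K) q :=
      fun K q => ((hsumm q).sum_add_tsum_nat_add K).symm
    set B : (Fin n → ℝ) × (Fin n → ℝ) → E := fun q => ∑' j, b j q with hBdef
    have hBs : Sm B := by
      refine contDiff_infty.2 fun N => ?_
      have : B = fun q => ∑ j ∈ Finset.range (max N K0), b j q + ∑' j, b (j + max N K0) q :=
        funext (hsplit _)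
      rw [this]
      exact ((Sm.sum _ fun j _ => hb j).of_le (by exact_mod_cast le_top)).add
        (hT N _ (le_max_left _ _) (le_max_right _ _)).1
    have hTs : ∀ K, Sm (fun q => ∑' j, b (j + K) q) := by
      intro K
      have : (fun q => ∑' j, b (j + K) q) = fun q => B q - ∑ j ∈ Finset.range K, b j q := by
        funext q; rw [hBdef]; simp only; rw [hsplit K q]; simp
      rw [this]
      exact hBs.sub (Sm.sum _ fun j _ => hb j)
    have hR : ∀ k, GS σ (l (k + 1)) (m (k + 1))
        (fun q => B q - ∑ j ∈ Finset.range k, f (j + 1) q) := by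
      intro k N
      set K := max (k + 1) (max N K0) with hK
      have hkK : k + 1 ≤ K := le_max_left _ _
      have hNK : N ≤ K := (le_max_left _ _).trans (le_max_right _ _)
      have hK0K : K0 ≤ K := (le_max_right _ _).trans (le_max_right _ _)
      have hrep : (fun q => B q - ∑ j ∈ Finset.range k, f (j + 1) q) = fun q =>
          (∑ j ∈ Finset.Ico k K, b j q - ∑ j ∈ Finset.range k, r j q) + ∑' j, b (j + K) q := by
        funext q
        rw [hBdef]; simp only
        rw [hsplit K q, ← Finset.sum_range_add_sum_Ico _ (show k ≤ K by omega)]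
        have : ∑ j ∈ Finset.range k, b j q =
            ∑ j ∈ Finset.range k, f (j + 1) q - ∑ j ∈ Finset.range k, r j q := by
          rw [← Finset.sum_sub_distrib]
          exact Finset.sum_congr rfl fun j _ => hbr j q
        rw [this]; abel
      rw [hrep]
      have hmu : ∀ (_ : Unit) q, 0 ≤ mu (n := n) σ (l (k + 1)) (m (k + 1)) q :=
        fun _ q => (mu_pos _ _ _ q).le
      have s1 : Sm (fun q => ∑ j ∈ Finset.Ico k K, b j q) := Sm.sum _ fun j _ => hb j
      have s2 : Sm (fun q => ∑ j ∈ Finset.range k, r j q) := Sm.sum _ fun j _ => hr j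
      refine FB.add (F := fun _ q => ∑ j ∈ Finset.Ico k K, b j q - ∑ j ∈ Finset.range k, r j q)
        (fun _ => s1.sub s2) (fun _ => hTs K) ?_ ?_
      · refine FB.sub (ww_nonneg σ) hmu (fun _ => s1) (fun _ => s2) ?_ ?_
        · refine FB.sum (ww_nonneg σ) _ hmu (F := fun j _ => b j) (fun j _ => hb j) fun j hj => ?_
          have hj := (Finset.mem_Ico.1 hj).1
          exact (hbG j).mono h0 (hl.antitone (by omega)) (hm.antitone (by omega)) N
        · exact FB.sum (ww_nonneg σ) _ hmu (F := fun j _ => r j) (fun j _ => hr j) fun j hj =>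
            hrG j _ _ N
      · exact (hT N K hNK hK0K).2.mono1 (ww_nonneg σ) fun _ q =>
          mu_mono h0 (hl.antitone hkK) (hm.antitone hkK) q
    refine ⟨fun x ϑ => f 0 (x, ϑ) + B (x, ϑ), fun k => ?_⟩
    cases k with
    | zero =>
      apply Ssym_of_GS
      · simpa using (hf 0).add hBs
      · simp only [Finset.range_zero, Finset.sum_empty, sub_zero]
        have hB0 : GS σ (l 0) (m 0) B := by
          have := (hR 0).mono h0 (hl.antitone (Nat.zero_le 1)) (hm.antitone (Nat.zero_le 1))
          simpa using this
        exact fun N => FB.add (fun _ => hf 0) (fun _ => hBs) (hG 0 N) (hB0 N)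
    | succ k =>
      have hrep : (fun q : (Fin n → ℝ) × (Fin n → ℝ) => f 0 (q.1, q.2) + B (q.1, q.2) -
          ∑ j ∈ Finset.range (k + 1), a j q.1 q.2) =
          fun q => B q - ∑ j ∈ Finset.range k, f (j + 1) q := by
        funext q
        rw [Finset.sum_range_succ']
        simp only [hfdef]
        abel
      apply Ssym_of_GS
      · rw [hrep]
        exact hBs.sub (Sm.sum _ fun j _ => hf _)
      · rw [hrep]
        exact hR k
  · intro A A' hA hA' l' m'
    obtain ⟨k, hk1, hk2⟩ := ((hl'.eventually_le_atBot l').and (hm'.eventually_le_atBot m')).exists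
    have hrep : (fun q : (Fin n → ℝ) × (Fin n → ℝ) => A q.1 q.2 - A' q.1 q.2) = fun q =>
        (A q.1 q.2 - ∑ j ∈ Finset.range k, a j q.1 q.2) -
          (A' q.1 q.2 - ∑ j ∈ Finset.range k, a j q.1 q.2) := by
      funext q; abel
    have s1 : Sm (fun q : (Fin n → ℝ) × (Fin n → ℝ) =>
      A q.1 q.2 - ∑ j ∈ Finset.range k, a j q.1 q.2) := (hA k).1
    have s2 : Sm (fun q : (Fin n → ℝ) × (Fin n → ℝ) =>
      A' q.1 q.2 - ∑ j ∈ Finset.range k, a j q.1 q.2) := (hA' k).1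
    apply Ssym_of_GS
    · rw [hrep]; exact s1.sub s2
    · rw [hrep]
      exact ((GS_of_Ssym (hA k)).sub s1 s2 (GS_of_Ssym (hA' k))).mono h0 hk1 hk2

end mainsec

/-- Asymptotic completeness of the symbol spaces: any sequence
`a_j ∈ S_σ^{l_j,m_j}` with `l_j, m_j` strictly decreasing to `-∞` admits an
asymptotic sum `a ∼ Σ a_j`, unique modulo `S_σ^{-∞}`. -/
theorem statement7 {n : ℕ} {E : Type*} [NormedAddCommGroup E] [NormedSpace ℝ E]
    [FiniteDimensional ℝ E]
    (σ : ℝ) (hσ : σ ∈ Set.Icc (0 : ℝ) 1)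
    (l m : ℕ → ℝ) (hl : StrictAnti l) (hm : StrictAnti m)
    (hl' : Filter.Tendsto l Filter.atTop Filter.atBot)
    (hm' : Filter.Tendsto m Filter.atTop Filter.atBot)
    (a : ℕ → (Fin n → ℝ) → (Fin n → ℝ) → E)
    (ha : ∀ j, Ssym σ (l j) (m j) (a j)) :
    (∃ A : (Fin n → ℝ) → (Fin n → ℝ) → E, ∀ k : ℕ,
      Ssym σ (l k) (m k) (fun x ϑ => A x ϑ - ∑ j ∈ Finset.range k, a j x ϑ)) ∧
    (∀ A A' : (Fin n → ℝ) → (Fin n → ℝ) → E,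
      (∀ k : ℕ, Ssym σ (l k) (m k) (fun x ϑ => A x ϑ - ∑ j ∈ Finset.range k, a j x ϑ)) →
      (∀ k : ℕ, Ssym σ (l k) (m k) (fun x ϑ => A' x ϑ - ∑ j ∈ Finset.range k, a j x ϑ)) →
      ∀ l' m' : ℝ, Ssym σ l' m' (fun x ϑ => A x ϑ - A' x ϑ)) := by
  exact main7 σ hσ l m hl hm hl' hm' a ha
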